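/- Suppose Φ : P → ℂ is an injective holomorphic map on a domain P satisfying the Abel functional equation Φ(g(z)) = Φ(z) + 1 for a holomorphic map g : P → P (whenever both sides are defined). Then any other injective holomorphic solution Ψ of the same equation on a connected P with Φ(P) containing a right half-plane differs from Φ by an additive constant: Ψ = Φ + const. -/

import Mathlib

open Filter Topology Metric

theorem Set.InjOn.not_eventually_eq_const {f : ℂ → ℂ} {U : Set ℂ} (hf : Set.InjOn f U) {z : ℂ}
    (hU : U ∈ 𝓝 z) : ¬ ∀ᶠ w in 𝓝 z, f w = f z := by
  intro h
  have hne : ∃ᶠ w in 𝓝[≠] z, w = z := by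
    refine Eventually.frequently ?_
    filter_upwards [nhdsWithin_le_nhds h, nhdsWithin_le_nhds hU] with w hw hwU
    exact hf hwU (mem_of_mem_nhds hU) hw
  exact hne eventually_mem_nhdsWithin

theorem AnalyticAt.eventually_eq_const_of_eventually_deriv_eq_zero {f : ℂ → ℂ} {z : ℂ}
    (hf : AnalyticAt ℂ f z) (h : ∀ᶠ w in 𝓝 z, deriv f w = 0) : ∀ᶠ w in 𝓝 z, f w = f z := by
  obtain ⟨r, hr, hball⟩ := Metric.eventually_nhds_iff_ball.1 (h.and hf.eventually_analyticAt)
  filter_upwards [ball_mem_nhds z hr] with w hw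
  exact isOpen_ball.is_const_of_deriv_eq_zero (convex_ball z r).isPreconnected
    (fun x hx => (hball x hx).2.differentiableAt.differentiableWithinAt)
    (fun x hx => (hball x hx).1) hw (mem_ball_self hr)

/-- A right inverse, with values in `U`, of an injective holomorphic function on `U` is
holomorphic. -/
theorem DifferentiableOn.differentiableOn_of_injOn_of_rightInvOn {f k : ℂ → ℂ} {U V : Set ℂ}
    (hU : IsOpen U) (hV : IsOpen V) (hf : DifferentiableOn ℂ f U) (hinj : Set.InjOn f U)
    (hk : Set.MapsTo k V U) (hfk : Set.RightInvOn k f V) : DifferentiableOn ℂ k V := by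
  have hcont : ∀ a ∈ V, ContinuousAt k a := by
    intro a ha N hN
    have hUa : U ∈ 𝓝 (k a) := hU.mem_nhds (hk ha)
    have hopen : 𝓝 a ≤ map f (𝓝 (k a)) := by
      have := ((hf.analyticAt hUa).eventually_constant_or_nhds_le_map_nhds).resolve_left
        (hinj.not_eventually_eq_const hUa)
      rwa [hfk ha] at this
    have himage : f '' (N ∩ U) ∈ 𝓝 a := hopen (image_mem_map (inter_mem hN hUa))
    change k ⁻¹' N ∈ 𝓝 a
    filter_upwards [himage, hV.mem_nhds ha] with y hy hyV
    obtain ⟨x, ⟨hxN, hxU⟩, rfl⟩ := hy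
    rwa [Set.mem_preimage, hinj (hk hyV) hxU (hfk hyV)]
  intro a ha
  have hUa : U ∈ 𝓝 (k a) := hU.mem_nhds (hk ha)
  have hfa := hf.analyticAt hUa
  have hderiv : ∀ᶠ w in 𝓝[≠] (k a), _root_.deriv f w ≠ 0 :=
    hfa.deriv.eventually_eq_zero_or_eventually_ne_zero.resolve_left fun h =>
      hinj.not_eventually_eq_const hUa (hfa.eventually_eq_const_of_eventually_deriv_eq_zero h)
  have htendsto : Tendsto k (𝓝[≠] a) (𝓝[≠] (k a)) := by
    refine tendsto_nhdsWithin_iff.2 ⟨(hcont a ha).tendsto.mono_left nhdsWithin_le_nhds, ?_⟩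
    filter_upwards [eventually_mem_nhdsWithin, nhdsWithin_le_nhds (hV.mem_nhds ha)] with y hy hyV h
    exact hy (by rw [Set.mem_singleton_iff, ← hfk hyV, ← hfk ha, Set.mem_singleton_iff.1 h])
  refine (Complex.analyticAt_of_differentiable_on_punctured_nhds_of_continuousAt ?_
    (hcont a ha)).differentiableAt.differentiableWithinAt
  filter_upwards [htendsto.eventually hderiv, nhdsWithin_le_nhds (hV.mem_nhds ha)] with y hy hyV
  refine (HasDerivAt.of_local_left_inverse (hcont y hyV)
    (hf.differentiableAt (hU.mem_nhds (hk hyV))).hasDerivAt hy ?_).differentiableAt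
  filter_upwards [hV.mem_nhds hyV] with x hx using hfk hx

/-- An entire function of at most linear growth is affine. -/
theorem Differentiable.eq_affine_of_norm_le_mul_norm_sub {h : ℂ → ℂ} (hh : Differentiable ℂ h)
    {c : ℂ} {C : ℝ} (hC : ∀ z, 1 ≤ ‖z - c‖ → ‖h z‖ ≤ C * ‖z - c‖) :
    ∃ b : ℂ, ∀ z, h z = h c + b * (z - c) := by
  have hd : Differentiable ℂ (dslope h c) := by
    rw [← differentiableOn_univ, Complex.differentiableOn_dslope univ_mem]
    exact hh.differentiableOn
  obtain ⟨M, hM⟩ := (isCompact_closedBall c 1).exists_bound_of_continuousOn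
    hd.continuous.continuousOn
  have hb : Bornology.IsBounded (Set.range (dslope h c)) := by
    refine isBounded_iff_forall_norm_le.2 ⟨max M (C + ‖h c‖), ?_⟩
    rintro _ ⟨z, rfl⟩
    rcases le_total ‖z - c‖ 1 with hz | hz
    · exact (hM z (mem_closedBall_iff_norm.2 hz)).trans (le_max_left _ _)
    · refine le_trans ?_ (le_max_right _ _)
      have hpos : 0 < ‖z - c‖ := zero_lt_one.trans_le hz
      have hzc : z ≠ c := sub_ne_zero.1 (norm_pos_iff.1 hpos)
      rw [dslope_of_ne _ hzc, slope_def_field, norm_div, div_le_iff₀ hpos]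
      have h1 := norm_sub_le (h z) (h c)
      have h2 := hC z hz
      nlinarith [norm_nonneg (h c)]
  obtain ⟨b, hb⟩ := hd.exists_const_forall_eq_of_bounded hb
  refine ⟨b, fun z => ?_⟩
  have := sub_smul_dslope h c z
  rw [hb z, smul_eq_mul] at this
  linear_combination -this

/-- An injective entire function is affine. -/
theorem Differentiable.eq_affine_of_injective {f : ℂ → ℂ} (hf : Differentiable ℂ f)
    (hinj : Function.Injective f) : ∃ a b : ℂ, ∀ z, f z = a * z + b := by
  obtain ⟨c, hc⟩ : ∃ c, _root_.deriv f c ≠ 0 := by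
    by_contra! h
    exact zero_ne_one (hinj (is_const_of_deriv_eq_zero hf h 0 1))
  have hd : Differentiable ℂ (dslope f c) := by
    rw [← differentiableOn_univ, Complex.differentiableOn_dslope univ_mem]
    exact hf.differentiableOn
  have hne : ∀ z, dslope f c z ≠ 0 := by
    intro z
    rcases eq_or_ne z c with rfl | hz
    · rwa [dslope_same]
    · rw [dslope_of_ne _ hz, slope_def_field]
      exact div_ne_zero (sub_ne_zero.2 (hinj.ne hz)) (sub_ne_zero.2 hz)
  have hopen : 𝓝 (f c) ≤ map f (𝓝 c) :=
    ((hf.analyticAt c).eventually_constant_or_nhds_le_map_nhds).resolve_left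
      (hinj.injOn.not_eventually_eq_const univ_mem)
  obtain ⟨δ, hδ, hball⟩ := Metric.mem_nhds_iff.1
    (hopen (image_mem_map (ball_mem_nhds c zero_lt_one)))
  have hfar : ∀ z, 1 ≤ ‖z - c‖ → δ ≤ ‖f z - f c‖ := by
    intro z hz
    by_contra! hlt
    obtain ⟨w, hw, hwz⟩ := hball (mem_ball_iff_norm.2 hlt)
    rw [hinj hwz, mem_ball_iff_norm] at hw
    exact hw.not_ge hz
  obtain ⟨b, hb⟩ := (hd.fun_inv hne).eq_affine_of_norm_le_mul_norm_sub (c := c) (C := δ⁻¹) (by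
    intro z hz
    have hzc : z ≠ c := sub_ne_zero.1 (norm_pos_iff.1 (zero_lt_one.trans_le hz))
    rw [dslope_of_ne _ hzc, slope_def_field, inv_div, norm_div, div_eq_inv_mul]
    gcongr
    exact hfar z hz)
  have hb0 : b = 0 := by
    by_contra hb0
    refine inv_ne_zero (hne (c - (dslope f c c)⁻¹ / b)) ?_
    rw [hb]
    field_simp
    ring
  refine ⟨dslope f c c, f c - dslope f c c * c, fun z => ?_⟩
  have hz : dslope f c z = dslope f c c := inv_injective (by simpa [hb0] using hb z)
  have := sub_smul_dslope f c z
  rw [hz, smul_eq_mul] at this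
  linear_combination -this

/-- An injective holomorphic function on a right half-plane that commutes with the unit
translation is a translation. -/
theorem eq_add_const_of_injOn_of_map_add_one {F : ℂ → ℂ} {R : ℝ}
    (hF : DifferentiableOn ℂ F {z | R < z.re}) (hinj : Set.InjOn F {z | R < z.re})
    (hadd : ∀ z : ℂ, R < z.re → F (z + 1) = F z + 1) :
    ∃ c : ℂ, ∀ z : ℂ, R < z.re → F z = z + c := by
  have hnat : ∀ (n : ℕ) (z : ℂ), R < z.re → F (z + n) = F z + n := by
    intro n z hz
    induction n with
    | zero => simp
    | succ n ih =>
      have hn : (0 : ℝ) ≤ n := n.cast_nonneg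
      rw [Nat.cast_succ, ← add_assoc, hadd _ (by simp; linarith), ih, add_assoc]
  have hlarge : ∀ z : ℂ, ∃ n : ℕ, R < (z + n).re := by
    intro z
    obtain ⟨n, hn⟩ := exists_nat_gt (R - z.re)
    exact ⟨n, by simp; linarith⟩
  choose N hN using hlarge
  set E : ℂ → ℂ := fun z => F (z + N z) - N z with hE
  have hEeq : ∀ (n : ℕ) (z : ℂ), R < (z + n).re → E z = F (z + n) - n := by
    intro n z hz
    have h1 := hnat n _ (hN z)
    have h2 := hnat (N z) _ hz
    rw [add_right_comm] at h2
    simp only [hE]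
    linear_combination h2 - h1
  have hEdiff : Differentiable ℂ E := by
    intro z
    have hopen : IsOpen {w : ℂ | R < (w + N z).re} :=
      isOpen_lt continuous_const (by fun_prop)
    have hFz : DifferentiableAt ℂ F (z + N z) :=
      hF.differentiableAt ((isOpen_lt continuous_const Complex.continuous_re).mem_nhds (hN z))
    have hloc : DifferentiableAt ℂ (fun w => F (w + N z) - N z) z :=
      (differentiableAt_comp_add_const.2 hFz).sub_const _
    refine hloc.congr_of_eventuallyEq ?_
    filter_upwards [hopen.mem_nhds (hN z)] with w hw using hEeq _ _ hw
  have hEinj : Function.Injective E := by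
    intro z w hzw
    have hz : R < (z + (N z + N w : ℕ)).re := by
      have h1 := hN z
      have hn : (0 : ℝ) ≤ N w := (N w).cast_nonneg
      simp at h1 ⊢; linarith
    have hw : R < (w + (N z + N w : ℕ)).re := by
      have h1 := hN w
      have hn : (0 : ℝ) ≤ N z := (N z).cast_nonneg
      simp at h1 ⊢; linarith
    rw [hEeq _ _ hz, hEeq _ _ hw] at hzw
    exact add_right_cancel (hinj hz hw (sub_left_injective hzw))
  have hEF : ∀ z : ℂ, R < z.re → E z = F z := fun z hz => by simpa using hEeq 0 z (by simpa)
  obtain ⟨a, b, hab⟩ := hEdiff.eq_affine_of_injective hEinj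
  have hFab : ∀ z : ℂ, R < z.re → F z = a * z + b := fun z hz => by rw [← hEF z hz, hab]
  have ha : a = 1 := by
    have hx : R < ((R + 1 : ℝ) : ℂ).re := by simp
    have hx1 : R < (((R + 1 : ℝ) : ℂ) + 1).re := by simp; linarith
    have := hadd _ hx
    rw [hFab _ hx1, hFab _ hx] at this
    linear_combination this
  exact ⟨b, fun z hz => by rw [hFab z hz, ha, one_mul]⟩

/-- Uniqueness of the Fatou coordinate up to an additive constant: if `Φ` and `Ψ` are
injective holomorphic solutions of the Abel equation `Φ(g z) = Φ z + 1` on a connected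
domain `P` (with `g : P → P` holomorphic), and `Φ(P)` contains a right half-plane,
then `Ψ = Φ + const` on `P`. -/
theorem fatou_coordinate_unique
    (P : Set ℂ) (hPopen : IsOpen P) (hPconn : IsPreconnected P) (hPne : P.Nonempty)
    (g : ℂ → ℂ) (hg : DifferentiableOn ℂ g P) (hgP : ∀ z ∈ P, g z ∈ P)
    (Φ Ψ : ℂ → ℂ)
    (hΦ : DifferentiableOn ℂ Φ P) (hΦinj : Set.InjOn Φ P)
    (hΨ : DifferentiableOn ℂ Ψ P) (hΨinj : Set.InjOn Ψ P)
    (hΦabel : ∀ z ∈ P, Φ (g z) = Φ z + 1)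
    (hΨabel : ∀ z ∈ P, Ψ (g z) = Ψ z + 1)
    (R : ℝ) (hhalf : {z : ℂ | R < z.re} ⊆ Φ '' P) :
    ∃ c : ℂ, ∀ z ∈ P, Ψ z = Φ z + c := by
  set H : Set ℂ := {z : ℂ | R < z.re} with hH
  have hHopen : IsOpen H := isOpen_lt continuous_const Complex.continuous_re
  set k : ℂ → ℂ := Function.invFunOn Φ P with hk
  have hkP : Set.MapsTo k H P := fun z hz => Function.invFunOn_mem (hhalf hz)
  have hΦk : Set.RightInvOn k Φ H := fun z hz => Function.invFunOn_eq (hhalf hz)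
  have hkdiff := hΦ.differentiableOn_of_injOn_of_rightInvOn hPopen hHopen hΦinj hkP hΦk
  have hkadd : ∀ z ∈ H, k (z + 1) = g (k z) := by
    intro z hz
    have hz1 : z + 1 ∈ H := by
      simp only [hH, Set.mem_ofPred_eq, Complex.add_re, Complex.one_re] at hz ⊢
      linarith
    refine hΦinj (hkP hz1) (hgP _ (hkP hz)) ?_
    rw [hΦk hz1, hΦabel _ (hkP hz), hΦk hz]
  obtain ⟨c, hc⟩ := eq_add_const_of_injOn_of_map_add_one (F := Ψ ∘ k) (hΨ.comp hkdiff hkP)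
    (hΨinj.comp hΦk.injOn hkP) fun z hz => by
      simp only [Function.comp_apply]
      rw [hkadd z hz, hΨabel _ (hkP hz)]
  have hz₀ : ((R + 1 : ℝ) : ℂ) ∈ H := by simp [hH]
  have hev : Ψ =ᶠ[𝓝 (k ((R + 1 : ℝ) : ℂ))] fun z => Φ z + c := by
    have hPz := hPopen.mem_nhds (hkP hz₀)
    have hΦH : ∀ᶠ z in 𝓝 (k ((R + 1 : ℝ) : ℂ)), Φ z ∈ H :=
      (hΦ.differentiableAt hPz).continuousAt.eventually_mem
        (by rw [hΦk hz₀]; exact hHopen.mem_nhds hz₀)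
    filter_upwards [hΦH, hPz] with z hz hzP
    have hkz : k (Φ z) = z := hΦinj (hkP hz) hzP (hΦk hz)
    simpa [hkz] using hc (Φ z) hz
  exact ⟨c, fun z hz => (hΨ.analyticOnNhd hPopen).eqOn_of_preconnected_of_eventuallyEq
    ((hΦ.add_const c).analyticOnNhd hPopen) hPconn (hkP hz₀) hev hz⟩
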